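/- arXiv:1808.07970 — 3 statements merged into one kernel-verified Lean document; each statement's English description precedes it below -/
import Mathlib

section
/- Let z ∈ ℂ with Im z > 0 and set q = e^{2πiz}. Then η(q)·f(q) = 2 Σ_{n∈ℤ} (−1)^n e^{2πiz(3n²+n)/2} / (1 + q^n), where the sum over ℤ converges absolutely (note 1 + q^n ≠ 0 for every n ∈ ℤ since |q| < 1). -/
/-- The q-Pochhammer symbol `(a;q)_n = ∏_{j=1}^n (1 - a q^{j-1})`. -/
noncomputable def qPoch (a q : ℂ) (n : ℕ) : ℂ := ∏ j ∈ Finset.range n, (1 - a * q ^ j)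

theorem qPoch_succ (a q : ℂ) (n : ℕ) : qPoch a q (n + 1) = qPoch a q n * (1 - a * q ^ n) :=
  Finset.prod_range_succ _ _

theorem qPoch_succ' (a q : ℂ) (n : ℕ) : qPoch a q (n + 1) = (1 - a) * qPoch (a * q) q n := by
  unfold qPoch
  rw [Finset.prod_range_succ', mul_comm]
  simp [pow_succ', mul_assoc]

/-- `1 / (q;q)_k`, extended by zero to negative `k`. -/
noncomputable def qInv (q : ℂ) (k : ℤ) : ℂ := if k < 0 then 0 else (qPoch q q k.toNat)⁻¹

theorem qInv_of_neg (q : ℂ) {k : ℤ} (hk : k < 0) : qInv q k = 0 := if_pos hk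

@[simp] theorem qInv_natCast (q : ℂ) (n : ℕ) : qInv q n = (qPoch q q n)⁻¹ := by simp [qInv]

@[simp] theorem qInv_zero (q : ℂ) : qInv q 0 = 1 := by simp [qInv, qPoch]

theorem one_sub_pow_ne_zero {q : ℂ} (hq : ‖q‖ < 1) (n : ℕ) : 1 - q ^ (n + 1) ≠ 0 := by
  intro h
  have : ‖q ^ (n + 1)‖ < 1 := by
    rw [norm_pow]; exact pow_lt_one₀ (norm_nonneg _) hq (by simp)
  rw [← sub_eq_zero.mp h] at this
  simp at this

theorem qInv_sub_one {q : ℂ} (hq : ‖q‖ < 1) (k : ℤ) :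
    qInv q (k - 1) = (1 - q ^ k) * qInv q k := by
  obtain hk | rfl | hk := lt_trichotomy k 0
  · simp [qInv_of_neg q hk, qInv_of_neg q (show k - 1 < 0 by omega)]
  · simp [qInv_of_neg]
  · obtain ⟨n, rfl⟩ : ∃ n : ℕ, k = (n + 1 : ℕ) := ⟨(k - 1).toNat, by omega⟩
    have h := one_sub_pow_ne_zero hq n
    rw [show ((n + 1 : ℕ) : ℤ) - 1 = n by simp, qInv_natCast, qInv_natCast, qPoch_succ,
      zpow_natCast, ← pow_succ', mul_inv]
    field_simp

theorem qInv_pascal {q : ℂ} (hq : ‖q‖ < 1) (hq0 : q ≠ 0) (a b : ℤ) :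
    (1 - q ^ (a + b)) * (qInv q a * qInv q b) =
      qInv q a * qInv q (b - 1) + q ^ b * (qInv q (a - 1) * qInv q b) := by
  rw [qInv_sub_one hq, qInv_sub_one hq, zpow_add₀ hq0]
  ring

theorem qInv_vandermonde {q : ℂ} (hq : ‖q‖ < 1) (hq0 : q ≠ 0) (M : ℕ) (s : ℤ) :
    ∑ m ∈ Finset.range (M + 1), q ^ ((m : ℤ) * (m + s)) *
      (qInv q (M - m) * (qInv q m * qInv q (m + s))) = qInv q M * qInv q (M + s) := by
  induction M generalizing s with
  | zero => simp [qPoch]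
  | succ M ih =>
    have h := one_sub_pow_ne_zero hq M
    refine mul_left_cancel₀ h ?_
    have key : ∀ m : ℕ, (1 - q ^ (M + 1)) * (q ^ ((m : ℤ) * (m + s)) *
        (qInv q ((M + 1 : ℕ) - m) * (qInv q m * qInv q (m + s)))) =
        q ^ ((m : ℤ) * (m + s)) * (qInv q ((M + 1 : ℕ) - m) * qInv q (m - 1) * qInv q (m + s)) +
        q ^ ((m : ℤ) * (m + (s + 1))) * (qInv q (M - m) * (qInv q m * qInv q (m + s))) := by
      intro m
      have := qInv_pascal hq hq0 ((M + 1 : ℕ) - m) m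
      rw [show ((M + 1 : ℕ) - m + m : ℤ) = (M + 1 : ℕ) by ring, zpow_natCast,
        show ((M + 1 : ℕ) - m - 1 : ℤ) = M - m by push_cast; ring] at this
      rw [show (m : ℤ) * (m + (s + 1)) = m * (m + s) + m by ring, zpow_add₀ hq0]
      linear_combination q ^ ((m : ℤ) * (m + s)) * qInv q (m + s) * this
    rw [Finset.mul_sum, Finset.sum_congr rfl fun m _ => key m, Finset.sum_add_distrib,
      Finset.sum_range_succ', Finset.sum_range_succ _ (M + 1)]
    have e1 : qInv q ((0 : ℕ) - 1) = 0 := qInv_of_neg _ (by simp)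
    have e2 : qInv q (M - (M + 1 : ℕ)) = 0 := qInv_of_neg _ (by simp)
    rw [e1, e2]
    simp only [zero_mul, mul_zero, add_zero]
    rw [← Finset.sum_add_distrib]
    have e3 := ih (s + 1)
    rw [show (M : ℤ) + (s + 1) = (M + 1 : ℕ) + s by push_cast; ring] at e3
    have e4 := qInv_sub_one hq ((M + 1 : ℕ) : ℤ)
    rw [zpow_natCast, show ((M + 1 : ℕ) : ℤ) - 1 = M by simp] at e4
    rw [← mul_assoc, ← e4, ← e3]
    refine Finset.sum_congr rfl fun m _ => ?_
    have e5 := qInv_sub_one hq ((m : ℤ) + s + 1)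
    rw [add_sub_cancel_right] at e5
    rw [e5]
    push_cast
    rw [show (M + 1 : ℤ) - (m + 1) = M - m by ring, show (m + 1 : ℤ) - 1 = m by ring,
      show (m + 1 : ℤ) + s = m + s + 1 by ring, ← add_assoc,
      show (m + 1 : ℤ) * (m + s + 1) = m * (m + s + 1) + (m + s + 1) by ring, zpow_add₀ hq0]
    ring

theorem qInv_partialFractions {q : ℂ} (hq : ‖q‖ < 1) (hq0 : q ≠ 0) {m k : ℕ} (hk : k ≤ m) (y : ℂ)
    (hy : ∀ i : ℕ, 1 - y * q ^ i ≠ 0) :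
    ∑ i ∈ Finset.range (m + 1), (-1) ^ i * q ^ ((i + 1).choose 2) / (q ^ i) ^ k *
      (qInv q i * qInv q (m - i)) / (1 - y * q ^ i) = y ^ k / qPoch y q (m + 1) := by
  induction m generalizing k y with
  | zero =>
    obtain rfl : k = 0 := by omega
    simp [qPoch]
  | succ m ih =>
    have h := one_sub_pow_ne_zero hq m
    have hy' : ∀ i : ℕ, 1 - y * q * q ^ i ≠ 0 := fun i => by
      simpa [pow_succ', mul_assoc] using hy (i + 1)
    have hP : qPoch (y * q) q m ≠ 0 := Finset.prod_ne_zero_iff.mpr fun i _ => hy' i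
    have h0 : 1 - y ≠ 0 := by simpa using hy 0
    have hm : 1 - y * q ^ (m + 1) ≠ 0 := hy _
    have hm' : 1 - y * q * q ^ m ≠ 0 := hy' _
    refine mul_left_cancel₀ h ?_
    have hpas : ∀ i : ℕ, (1 - q ^ (m + 1)) * (qInv q i * qInv q ((m + 1 : ℕ) - i)) =
        qInv q i * qInv q (m - i) +
          q ^ (((m + 1 : ℕ) : ℤ) - i) * (qInv q (i - 1) * qInv q ((m + 1 : ℕ) - i)) := by
      intro i
      have := qInv_pascal hq hq0 i ((m + 1 : ℕ) - i)
      rwa [add_sub_cancel, zpow_natCast,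
        show ((m + 1 : ℕ) - i - 1 : ℤ) = m - i by push_cast; ring] at this
    have hpas' : ∀ i : ℕ, (1 - q ^ (m + 1)) * (qInv q i * qInv q ((m + 1 : ℕ) - i)) =
        q ^ i * (qInv q i * qInv q (m - i)) + qInv q (i - 1) * qInv q ((m + 1 : ℕ) - i) := by
      intro i
      have := qInv_pascal hq hq0 ((m + 1 : ℕ) - i) i
      rw [sub_add_cancel, zpow_natCast, zpow_natCast,
        show ((m + 1 : ℕ) - i - 1 : ℤ) = m - i by push_cast; ring] at this
      linear_combination this
    have e1 : qInv q ((0 : ℕ) - 1) = 0 := qInv_of_neg _ (by simp)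
    have e2 : qInv q (m - (m + 1 : ℕ)) = 0 := qInv_of_neg _ (by simp)
    have e3 : ∀ i : ℕ, (((i + 1 : ℕ) : ℤ) - 1) = i := fun i => by simp
    have e4 : ∀ i : ℕ, (((m + 1 : ℕ) : ℤ) - (i + 1 : ℕ)) = m - i := fun i => by push_cast; ring
    have hch : ∀ i : ℕ, (i + 1 + 1).choose 2 = (i + 1).choose 2 + (i + 1) := fun i => by
      rw [Nat.choose_succ_succ' (i + 1) 1, Nat.choose_one_right, add_comm]
    rcases Nat.lt_or_ge m k with hmk | hkm
    · obtain rfl : k = m + 1 := by omega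
      have key : ∀ i : ℕ, (1 - q ^ (m + 1)) * ((-1) ^ i * q ^ ((i + 1).choose 2) /
          (q ^ i) ^ (m + 1) * (qInv q i * qInv q ((m + 1 : ℕ) - i)) / (1 - y * q ^ i)) =
          (-1) ^ i * q ^ ((i + 1).choose 2) / (q ^ i) ^ m *
            (qInv q i * qInv q (m - i)) / (1 - y * q ^ i) +
          (-1) ^ i * q ^ ((i + 1).choose 2) / (q ^ i) ^ (m + 1) *
            (qInv q (i - 1) * qInv q ((m + 1 : ℕ) - i)) / (1 - y * q ^ i) := by
        intro i
        have hqi : q ^ i ≠ 0 := pow_ne_zero _ hq0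
        have := hpas' i
        rw [show (-1) ^ i * q ^ ((i + 1).choose 2) / (q ^ i) ^ m =
          (-1) ^ i * q ^ ((i + 1).choose 2) / (q ^ i) ^ (m + 1) * q ^ i by
            rw [pow_succ (q ^ i) m]; field_simp]
        linear_combination
          (-1) ^ i * q ^ ((i + 1).choose 2) / (q ^ i) ^ (m + 1) / (1 - y * q ^ i) * this
      rw [Finset.mul_sum, Finset.sum_congr rfl fun i _ => key i, Finset.sum_add_distrib,
        Finset.sum_range_succ, Finset.sum_range_succ' _ (m + 1), e1, e2]
      simp only [zero_mul, mul_zero, add_zero, zero_div]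
      rw [ih le_rfl y hy]
      have : ∑ i ∈ Finset.range (m + 1), (-1) ^ (i + 1) * q ^ ((i + 1 + 1).choose 2) /
          (q ^ (i + 1)) ^ (m + 1) * (qInv q (((i + 1 : ℕ) : ℤ) - 1) *
            qInv q ((m + 1 : ℕ) - (i + 1 : ℕ))) / (1 - y * q ^ (i + 1)) =
          -(q ^ m)⁻¹ * ((y * q) ^ m / qPoch (y * q) q (m + 1)) := by
        rw [← ih le_rfl (y * q) hy', Finset.mul_sum]
        refine Finset.sum_congr rfl fun i _ => ?_
        rw [e3, e4, hch, show y * q * q ^ i = y * q ^ (i + 1) by ring]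
        have hi := hy (i + 1)
        have hqi : q ^ i ≠ 0 := pow_ne_zero _ hq0
        rw [pow_succ (q ^ (i + 1)), pow_add, pow_succ q i, mul_pow]
        rw [pow_succ] at hi
        field_simp
        ring
      rw [this, qPoch_succ (y * q), qPoch_succ' _ _ (m + 1), qPoch_succ', qPoch_succ, mul_pow]
      field_simp
      ring
    · have key : ∀ i : ℕ, (1 - q ^ (m + 1)) * ((-1) ^ i * q ^ ((i + 1).choose 2) /
          (q ^ i) ^ k * (qInv q i * qInv q ((m + 1 : ℕ) - i)) / (1 - y * q ^ i)) =
          (-1) ^ i * q ^ ((i + 1).choose 2) / (q ^ i) ^ k *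
            (qInv q i * qInv q (m - i)) / (1 - y * q ^ i) +
          (-1) ^ i * q ^ ((i + 1).choose 2) / (q ^ i) ^ k * q ^ (((m + 1 : ℕ) : ℤ) - i) *
            (qInv q (i - 1) * qInv q ((m + 1 : ℕ) - i)) / (1 - y * q ^ i) := by
        intro i
        have := hpas i
        linear_combination (-1) ^ i * q ^ ((i + 1).choose 2) / (q ^ i) ^ k / (1 - y * q ^ i) * this
      rw [Finset.mul_sum, Finset.sum_congr rfl fun i _ => key i, Finset.sum_add_distrib,
        Finset.sum_range_succ, Finset.sum_range_succ' _ (m + 1), e1, e2]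
      simp only [zero_mul, mul_zero, add_zero, zero_div]
      rw [ih hkm y hy]
      have : ∑ i ∈ Finset.range (m + 1), (-1) ^ (i + 1) * q ^ ((i + 1 + 1).choose 2) /
          (q ^ (i + 1)) ^ k * q ^ (((m + 1 : ℕ) : ℤ) - (i + 1 : ℕ)) *
          (qInv q (((i + 1 : ℕ) : ℤ) - 1) *
            qInv q ((m + 1 : ℕ) - (i + 1 : ℕ))) / (1 - y * q ^ (i + 1)) =
          -q ^ (m + 1) / q ^ k * ((y * q) ^ k / qPoch (y * q) q (m + 1)) := by
        rw [← ih hkm (y * q) hy', Finset.mul_sum]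
        refine Finset.sum_congr rfl fun i _ => ?_
        rw [e3, e4, hch, show y * q * q ^ i = y * q ^ (i + 1) by ring]
        have hi := hy (i + 1)
        have hqi : q ^ i ≠ 0 := pow_ne_zero _ hq0
        rw [pow_add, zpow_sub₀ hq0, zpow_natCast, zpow_natCast, pow_succ q i, mul_pow]
        rw [pow_succ] at hi
        field_simp
        ring
      rw [this, qPoch_succ (y * q), qPoch_succ' _ _ (m + 1), qPoch_succ', qPoch_succ, mul_pow]
      field_simp
      ring

theorem qInv_vandermonde_symm {q : ℂ} (hq : ‖q‖ < 1) (hq0 : q ≠ 0) {N : ℕ} {r : ℤ}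
    (hr : r ∈ Finset.Icc (-N : ℤ) N) :
    ∑ n ∈ Finset.range (N + 1), q ^ (n ^ 2) * (qInv q (N - n) * (qInv q (n - r) * qInv q (n + r))) =
      q ^ (r ^ 2) * (qInv q (N - r) * qInv q (N + r)) := by
  have key : ∀ k : ℕ, k ≤ N → ∑ n ∈ Finset.range (N + 1),
      q ^ (n ^ 2) * (qInv q (N - n) * (qInv q (n - k) * qInv q (n + k))) =
      q ^ ((k : ℤ) ^ 2) * (qInv q (N - k) * qInv q (N + k)) := by
    intro k hk
    obtain ⟨M, rfl⟩ := Nat.exists_eq_add_of_le hk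
    rw [add_assoc, Finset.sum_range_add, Finset.sum_eq_zero, zero_add]
    · have := qInv_vandermonde hq hq0 M (2 * k)
      rw [show ((k + M : ℕ) : ℤ) - k = M by push_cast; ring,
        show ((k + M : ℕ) : ℤ) + k = M + 2 * k by push_cast; ring, ← this, Finset.mul_sum]
      refine Finset.sum_congr rfl fun m _ => ?_
      rw [show ((k + M : ℕ) : ℤ) - (k + m : ℕ) = M - m by push_cast; ring,
        show ((k + m : ℕ) : ℤ) - k = m by push_cast; ring,
        show ((k + m : ℕ) : ℤ) + k = m + 2 * k by push_cast; ring]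
      have hexp : q ^ ((k + m) ^ 2) = q ^ ((k : ℤ) ^ 2) * q ^ ((m : ℤ) * (m + 2 * k)) := by
        rw [← zpow_add₀ hq0, ← zpow_natCast]
        congr 1
        push_cast
        ring
      rw [hexp, mul_assoc]
    · intro n hn
      rw [Finset.mem_range] at hn
      rw [qInv_of_neg q (show (n : ℤ) - k < 0 by omega)]
      simp
  rw [Finset.mem_Icc] at hr
  obtain ⟨k, rfl | rfl⟩ := Int.eq_nat_or_neg r
  · exact key k (by omega)
  · have := key k (by omega)
    simp only [sub_neg_eq_add, ← sub_eq_add_neg, neg_sq]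
    simpa only [mul_comm (qInv q (_ + (k : ℤ)))] using this

/-- A finite form of the limiting case of Bailey's lemma relative to `a = 1`. -/
theorem bailey_lemma_finite {q : ℂ} (hq : ‖q‖ < 1) (hq0 : q ≠ 0) (α : ℤ → ℂ) (N : ℕ) :
    ∑ n ∈ Finset.range (N + 1), q ^ (n ^ 2) * (qInv q (N - n) *
      ∑ r ∈ Finset.Icc (-n : ℤ) n, α r * (qInv q (n - r) * qInv q (n + r))) =
    ∑ r ∈ Finset.Icc (-N : ℤ) N, α r * (q ^ (r ^ 2) * (qInv q (N - r) * qInv q (N + r))) := by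
  have h1 : ∀ n ∈ Finset.range (N + 1),
      ∑ r ∈ Finset.Icc (-n : ℤ) n, α r * (qInv q (n - r) * qInv q (n + r)) =
      ∑ r ∈ Finset.Icc (-N : ℤ) N, α r * (qInv q (n - r) * qInv q (n + r)) := by
    intro n hn
    rw [Finset.mem_range] at hn
    refine Finset.sum_subset (Finset.Icc_subset_Icc (by omega) (by omega)) fun r _ hr => ?_
    rw [Finset.mem_Icc, not_and_or, not_le, not_le] at hr
    rcases hr with hr | hr
    · rw [qInv_of_neg q (show (n : ℤ) + r < 0 by omega)]; simp
    · rw [qInv_of_neg q (show (n : ℤ) - r < 0 by omega)]; simp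
  rw [Finset.sum_congr rfl fun n hn => by rw [h1 n hn]]
  simp only [Finset.mul_sum]
  rw [Finset.sum_comm]
  refine Finset.sum_congr rfl fun r hr => ?_
  rw [← qInv_vandermonde_symm hq hq0 hr, Finset.mul_sum]
  exact Finset.sum_congr rfl fun n _ => by ring

theorem one_sub_norm_le_norm_one_add_zpow {q : ℂ} (hq : ‖q‖ < 1) (hq0 : q ≠ 0) (r : ℤ) :
    1 - ‖q‖ ≤ ‖1 + q ^ r‖ := by
  have hpos : 0 < ‖q‖ := norm_pos_iff.mpr hq0
  obtain hr | rfl | hr := lt_trichotomy r 0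
  · have h1 : 1 ≤ ‖q‖⁻¹ := (one_le_inv₀ hpos).mpr hq.le
    have h2 : ‖q‖⁻¹ ≤ ‖q ^ r‖ := by
      rw [norm_zpow, ← zpow_neg_one]
      exact zpow_le_zpow_right_of_le_one₀ hpos hq.le (by omega)
    have h3 : ‖q ^ r‖ - 1 ≤ ‖1 + q ^ r‖ := by
      simpa [add_comm] using norm_sub_le_norm_add (q ^ r) 1
    have h4 : 2 ≤ ‖q‖⁻¹ + ‖q‖ := by
      have := mul_inv_cancel₀ hpos.ne'
      nlinarith [sq_nonneg (1 - ‖q‖)]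
    linarith
  · simp only [zpow_zero]
    norm_num
    linarith
  · have h2 : ‖q ^ r‖ ≤ ‖q‖ := by
      rw [norm_zpow]
      simpa using zpow_le_zpow_right_of_le_one₀ hpos hq.le (show (1 : ℤ) ≤ r by omega)
    have h3 : 1 - ‖q ^ r‖ ≤ ‖1 + q ^ r‖ := by
      simpa using norm_sub_le_norm_add 1 (q ^ r)
    linarith

theorem one_add_zpow_ne_zero {q : ℂ} (hq : ‖q‖ < 1) (hq0 : q ≠ 0) (r : ℤ) : 1 + q ^ r ≠ 0 :=
  norm_pos_iff.mp <| (sub_pos.mpr hq).trans_le <| one_sub_norm_le_norm_one_add_zpow hq hq0 r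

theorem qPoch_neg_pow_inv {q : ℂ} (hq0 : q ≠ 0) (n : ℕ) :
    qPoch (-(q ^ n)⁻¹) q (2 * n + 1) * q ^ ((n + 1).choose 2) = 2 * qPoch (-q) q n ^ 2 := by
  induction n with
  | zero => simp [qPoch]; norm_num
  | succ n ih =>
    have hch : (n + 1 + 1).choose 2 = (n + 1).choose 2 + (n + 1) := by
      rw [Nat.choose_succ_succ' (n + 1) 1, Nat.choose_one_right, add_comm]
    have hq' : -(q ^ (n + 1))⁻¹ * q = -(q ^ n)⁻¹ := by field_simp; ring
    rw [show 2 * (n + 1) + 1 = 2 * n + 1 + 1 + 1 by ring, qPoch_succ', hq', qPoch_succ, hch,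
      qPoch_succ (-q), mul_pow]
    have h1 : (q ^ n)⁻¹ * q ^ (2 * n + 1) = q ^ (n + 1) := by field_simp; ring
    have h2 : (q ^ (n + 1))⁻¹ * q ^ (n + 1) = 1 := inv_mul_cancel₀ (pow_ne_zero _ hq0)
    rw [pow_add q ((n + 1).choose 2), neg_mul, h1]
    linear_combination (1 + q ^ (n + 1)) ^ 2 * ih + (1 + q ^ (n + 1)) *
      qPoch (-(q ^ n)⁻¹) q (2 * n + 1) * q ^ ((n + 1).choose 2) * h2

theorem sum_Icc_qInv_eq {q : ℂ} (hq : ‖q‖ < 1) (hq0 : q ≠ 0) (n : ℕ) :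
    ∑ r ∈ Finset.Icc (-n : ℤ) n, 2 * ((-1) ^ r * q ^ (r * (r + 1) / 2) / (1 + q ^ r)) *
      (qInv q (n - r) * qInv q (n + r)) = (qPoch (-q) q n ^ 2)⁻¹ := by
  have hone : ∀ i : ℕ, 1 - -(q ^ n)⁻¹ * q ^ i = 1 + q ^ ((i : ℤ) - n) := fun i => by
    rw [zpow_sub₀ hq0, zpow_natCast, zpow_natCast]; field_simp; ring
  have hy : ∀ i : ℕ, 1 - -(q ^ n)⁻¹ * q ^ i ≠ 0 := fun i => by
    rw [hone]; exact one_add_zpow_ne_zero hq hq0 _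
  have key := qInv_partialFractions hq hq0 (show n ≤ 2 * n by omega) _ hy
  have hC : (-1) ^ n * q ^ ((n + 1).choose 2) / q ^ (n ^ 2) ≠ 0 := by simp [hq0]
  have hsum : ∑ i ∈ Finset.range (2 * n + 1), (-1) ^ i * q ^ ((i + 1).choose 2) / (q ^ i) ^ n *
      (qInv q i * qInv q ((2 * n : ℕ) - i)) / (1 - -(q ^ n)⁻¹ * q ^ i) =
      (-1) ^ n * q ^ ((n + 1).choose 2) / q ^ (n ^ 2) *
      ∑ r ∈ Finset.Icc (-n : ℤ) n, ((-1) ^ r * q ^ (r * (r + 1) / 2) / (1 + q ^ r)) *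
      (qInv q (n - r) * qInv q (n + r)) := by
    rw [Finset.mul_sum]
    refine Finset.sum_nbij (fun i : ℕ => (i : ℤ) - n) ?_ ?_ ?_ ?_
    · intro i hi
      rw [Finset.mem_range] at hi
      rw [Finset.mem_Icc]
      omega
    · intro i _ j _ h
      simpa using h
    · intro r hr
      rw [Finset.mem_coe, Finset.mem_Icc] at hr
      refine ⟨(r + n).toNat, ?_, ?_⟩
      · rw [Finset.mem_coe, Finset.mem_range]
        omega
      · simp only
        omega
    · intro i _
      rw [hone, show (n : ℤ) - (i - n) = (2 * n : ℕ) - i by push_cast; ring, add_sub_cancel]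
      have htri : ∀ a : ℕ, 2 * ((a + 1).choose 2 : ℤ) = (a + 1) * a := fun a => by
        have h : 2 * (a + 1).choose 2 = (a + 1) * a := by
          rw [Nat.choose_two_right, Nat.add_sub_cancel]
          exact Nat.mul_div_cancel' (by rw [mul_comm]; exact (Nat.even_mul_succ_self a).two_dvd)
        exact_mod_cast h
      have hr : 2 * (((i : ℤ) - n) * (i - n + 1) / 2) = (i - n) * (i - n + 1) :=
        Int.mul_ediv_cancel' (Int.even_mul_succ_self _).two_dvd
      have hexp : ((i + 1).choose 2 : ℤ) = ((i : ℤ) - n) * (i - n + 1) / 2 + (i * n : ℕ) +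
          ((n + 1).choose 2 : ℕ) - (n ^ 2 : ℕ) := by
        have : 2 * ((i + 1).choose 2 : ℤ) = 2 * (((i : ℤ) - n) * (i - n + 1) / 2 + (i * n : ℕ) +
          ((n + 1).choose 2 : ℕ) - (n ^ 2 : ℕ)) := by
          push_cast
          linear_combination htri i - htri n - hr
        omega
      have hpow : q ^ ((i + 1).choose 2) = q ^ (((i : ℤ) - n) * (i - n + 1) / 2) * (q ^ i) ^ n *
          q ^ ((n + 1).choose 2) / q ^ (n ^ 2) := by
        rw [← zpow_natCast q ((i + 1).choose 2), hexp, zpow_sub₀ hq0, zpow_add₀ hq0, zpow_add₀ hq0,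
          zpow_natCast, zpow_natCast, zpow_natCast, pow_mul]
      have hqi : q ^ i ≠ 0 := pow_ne_zero _ hq0
      have hne := one_add_zpow_ne_zero hq hq0 ((i : ℤ) - n)
      rw [hpow, zpow_sub₀ (by norm_num : (-1 : ℂ) ≠ 0), zpow_natCast, zpow_natCast]
      field_simp
  rw [hsum] at key
  have hQ : qPoch (-q) q n ≠ 0 := Finset.prod_ne_zero_iff.mpr fun j _ => by
    have := one_add_zpow_ne_zero hq hq0 (j + 1 : ℕ)
    rw [zpow_natCast, pow_succ'] at this
    simpa using this
  have hP : qPoch (-(q ^ n)⁻¹) q (2 * n + 1) ≠ 0 :=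
    Finset.prod_ne_zero_iff.mpr fun i _ => hy i
  simp only [mul_assoc (2 : ℂ)]
  rw [← Finset.mul_sum]
  refine mul_left_cancel₀ hC ?_
  rw [mul_left_comm, key]
  have h := qPoch_neg_pow_inv hq0 n
  generalize qPoch (-(q ^ n)⁻¹) q (2 * n + 1) = P at h hP ⊢
  rw [neg_pow, inv_pow, ← pow_mul, ← pow_two]
  field_simp
  linear_combination -h

theorem tprod_ne_zero_and_tendsto_qPoch {a q : ℂ} (hq : ‖q‖ < 1) (ha : ∀ j : ℕ, 1 - a * q ^ j ≠ 0) :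
    ∏' j : ℕ, (1 - a * q ^ j) ≠ 0 ∧
      Filter.Tendsto (qPoch a q) Filter.atTop (nhds (∏' j : ℕ, (1 - a * q ^ j))) := by
  have hs : Summable fun j : ℕ => ‖-(a * q ^ j)‖ := by
    simpa using (summable_geometric_of_lt_one (norm_nonneg q) hq).mul_left ‖a‖
  constructor
  · simpa [sub_eq_add_neg] using tprod_one_add_ne_zero_of_summable (f := fun j => -(a * q ^ j))
      (fun j => by simpa [sub_eq_add_neg] using ha j) hs
  · have := (multipliable_one_add_of_summable hs).tendsto_prod_tprod_nat
    simp only [← sub_eq_add_neg] at this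
    exact this

theorem exists_norm_qPoch_inv_le {a q : ℂ} (hq : ‖q‖ < 1) (ha : ∀ j : ℕ, 1 - a * q ^ j ≠ 0) :
    ∃ B : ℝ, 0 ≤ B ∧ ∀ n, ‖(qPoch a q n)⁻¹‖ ≤ B := by
  obtain ⟨h0, h⟩ := tprod_ne_zero_and_tendsto_qPoch hq ha
  obtain ⟨B, hB⟩ := (h.inv₀ h0).norm.bddAbove_range
  have hB' : ∀ n, ‖(qPoch a q n)⁻¹‖ ≤ B := fun n => hB ⟨n, rfl⟩
  exact ⟨B, (norm_nonneg _).trans (hB' 0), hB'⟩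

theorem exists_norm_qInv_le {q : ℂ} (hq : ‖q‖ < 1) :
    ∃ B : ℝ, 0 ≤ B ∧ ∀ k, ‖qInv q k‖ ≤ B := by
  obtain ⟨B, hB0, hB⟩ := exists_norm_qPoch_inv_le (a := q) hq fun j => by
    simpa [pow_succ'] using one_sub_pow_ne_zero hq j
  refine ⟨B, hB0, fun k => ?_⟩
  unfold qInv
  split_ifs
  · simpa using hB0
  · exact hB _

theorem tendsto_qInv {q : ℂ} (hq : ‖q‖ < 1) :
    Filter.Tendsto (qInv q) Filter.atTop (nhds (∏' n : ℕ, (1 - q ^ (n + 1)))⁻¹) := by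
  obtain ⟨h0, h⟩ := tprod_ne_zero_and_tendsto_qPoch (a := q) hq fun j => by
    simpa [pow_succ'] using one_sub_pow_ne_zero hq j
  simp only [← pow_succ'] at h0 h
  have hnat : Filter.Tendsto Int.toNat Filter.atTop Filter.atTop :=
    Filter.tendsto_atTop.mpr fun b => by
      filter_upwards [Filter.eventually_ge_atTop (b : ℤ)] with k hk
      omega
  refine ((h.inv₀ h0).comp hnat).congr' ?_
  filter_upwards [Filter.eventually_ge_atTop (0 : ℤ)] with k hk
  simp [qInv, not_lt.mpr hk]

theorem norm_watson_term_le {q : ℂ} (hq : ‖q‖ < 1) (hq0 : q ≠ 0) (r : ℤ) :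
    ‖(-1) ^ r * q ^ (r * (3 * r + 1) / 2) / (1 + q ^ r)‖ ≤ ‖q‖ ^ r.natAbs * (1 - ‖q‖)⁻¹ := by
  have hpos : 0 < ‖q‖ := norm_pos_iff.mpr hq0
  have h1 : ‖(-1 : ℂ) ^ r‖ = 1 := by simp
  rw [norm_div, norm_mul, h1, one_mul, div_eq_mul_inv, norm_zpow]
  have hexp : (r.natAbs : ℤ) ≤ r * (3 * r + 1) / 2 := by
    rw [Int.le_ediv_iff_mul_le (by norm_num), Int.natCast_natAbs]
    rcases abs_cases r with ⟨h, h'⟩ | ⟨h, h'⟩ <;> rw [h]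
    · obtain rfl | h'' := h'.eq_or_lt
      · simp
      · nlinarith
    · nlinarith
  rw [← zpow_natCast]
  gcongr ?_ * ?_
  · exact zpow_le_zpow_right_of_le_one₀ hpos hq.le hexp
  · exact inv_anti₀ (sub_pos.mpr hq) (one_sub_norm_le_norm_one_add_zpow hq hq0 r)

theorem summable_pow_natAbs {x : ℝ} (h0 : 0 ≤ x) (h1 : x < 1) :
    Summable fun r : ℤ => x ^ r.natAbs :=
  .of_nat_of_neg (by simpa using summable_geometric_of_lt_one h0 h1)
    (by simpa using summable_geometric_of_lt_one h0 h1)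

theorem watson_identity {q : ℂ} (hq : ‖q‖ < 1) (hq0 : q ≠ 0) :
    (∏' n : ℕ, (1 - q ^ (n + 1))) * (∑' n : ℕ, q ^ (n ^ 2) / (qPoch (-q) q n) ^ 2) =
      2 * ∑' r : ℤ, (-1) ^ r * q ^ (r * (3 * r + 1) / 2) / (1 + q ^ r) := by
  set P := ∏' n : ℕ, (1 - q ^ (n + 1)) with hPdef
  have hP : P ≠ 0 := by
    have := (tprod_ne_zero_and_tendsto_qPoch (a := q) hq fun j => by
      simpa [pow_succ'] using one_sub_pow_ne_zero hq j).1
    simpa only [← pow_succ'] using this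
  obtain ⟨B, hB0, hB⟩ := exists_norm_qInv_le hq
  obtain ⟨C, hC0, hC⟩ := exists_norm_qPoch_inv_le (a := -q) hq fun j => by
    have := one_add_zpow_ne_zero hq hq0 (j + 1 : ℕ)
    rw [zpow_natCast, pow_succ'] at this
    simpa using this
  have hlin : ∀ c : ℤ, Filter.Tendsto (fun N : ℕ => qInv q (N + c)) Filter.atTop (nhds P⁻¹) :=
    fun c => (tendsto_qInv hq).comp
      (Filter.tendsto_atTop_add_const_right _ c tendsto_natCast_atTop_atTop)
  have hL : Filter.Tendsto (fun N : ℕ => ∑' n : ℕ,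
      q ^ (n ^ 2) / (qPoch (-q) q n) ^ 2 * qInv q (N - n)) Filter.atTop
      (nhds (∑' n : ℕ, q ^ (n ^ 2) / (qPoch (-q) q n) ^ 2 * P⁻¹)) := by
    refine tendsto_tsum_of_dominated_convergence (bound := fun n => ‖q‖ ^ n * C ^ 2 * B)
      (((summable_geometric_of_lt_one (norm_nonneg q) hq).mul_right _).mul_right _)
      (fun n => ?_) (Filter.Eventually.of_forall fun N n => ?_)
    · exact (hlin (-n)).const_mul _
    · rw [norm_mul, div_eq_mul_inv, norm_mul, ← inv_pow, norm_pow, norm_pow]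
      gcongr ?_ * ?_ ^ 2 * ?_
      · exact pow_le_pow_of_le_one (norm_nonneg _) hq.le (Nat.le_self_pow (by norm_num) n)
      · exact hC n
      · exact hB _
  have hR : Filter.Tendsto (fun N : ℕ => ∑' r : ℤ,
      (-1) ^ r * q ^ (r * (3 * r + 1) / 2) / (1 + q ^ r) * (qInv q (N - r) * qInv q (N + r)))
      Filter.atTop (nhds (∑' r : ℤ,
        (-1) ^ r * q ^ (r * (3 * r + 1) / 2) / (1 + q ^ r) * (P⁻¹ * P⁻¹))) := by
    refine tendsto_tsum_of_dominated_convergence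
      (bound := fun r : ℤ => ‖q‖ ^ r.natAbs * (1 - ‖q‖)⁻¹ * (B * B))
      (((summable_pow_natAbs (norm_nonneg q) hq).mul_right _).mul_right _)
      (fun r => ?_) (Filter.Eventually.of_forall fun N r => ?_)
    · exact ((hlin (-r)).mul (hlin r)).const_mul _
    · rw [norm_mul, norm_mul (qInv q _)]
      gcongr ?_ * (?_ * ?_)
      · exact norm_watson_term_le hq hq0 r
      · exact hB _
      · exact hB _
  have hfin : ∀ N : ℕ, ∑' n : ℕ, q ^ (n ^ 2) / (qPoch (-q) q n) ^ 2 * qInv q (N - n) =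
      2 * ∑' r : ℤ, (-1) ^ r * q ^ (r * (3 * r + 1) / 2) / (1 + q ^ r) *
        (qInv q (N - r) * qInv q (N + r)) := by
    intro N
    have h := bailey_lemma_finite hq hq0
      (fun r => 2 * ((-1) ^ r * q ^ (r * (r + 1) / 2) / (1 + q ^ r))) N
    simp only [sum_Icc_qInv_eq hq hq0] at h
    rw [tsum_eq_sum (s := Finset.range (N + 1)), tsum_eq_sum (s := Finset.Icc (-N : ℤ) N),
      Finset.mul_sum]
    · convert h using 2 with n _ r _
      · ring
      · have : q ^ (r * (3 * r + 1) / 2) = q ^ (r ^ 2) * q ^ (r * (r + 1) / 2) := by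
          rw [← zpow_add₀ hq0, ← Int.mul_add_ediv_left _ _ two_ne_zero]
          congr 2
          ring
        rw [this]
        ring
    · intro r hr
      rw [Finset.mem_Icc, not_and_or, not_le, not_le] at hr
      rcases hr with hr | hr
      · rw [qInv_of_neg q (show (N : ℤ) + r < 0 by omega)]; simp
      · rw [qInv_of_neg q (show (N : ℤ) - r < 0 by omega)]; simp
    · intro n hn
      rw [Finset.mem_range] at hn
      rw [qInv_of_neg q (show (N : ℤ) - n < 0 by omega), mul_zero]
  have heq := tendsto_nhds_unique hL ((hR.const_mul 2).congr fun N => (hfin N).symm)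
  rw [tsum_mul_right, tsum_mul_right] at heq
  field_simp at heq
  linear_combination heq

/-- Watson's identity: for `Im z > 0` and `q = e^{2πiz}`,
`η(q) f(q) = 2 Σ_{n∈ℤ} (-1)^n e^{2πiz(3n²+n)/2} / (1+qⁿ)`, the sum converging absolutely. -/
theorem stmt0 (z : ℂ) (hz : 0 < z.im) (q : ℂ)
    (hq : q = Complex.exp (2 * Real.pi * Complex.I * z)) :
    Summable (fun n : ℤ =>
      (-1 : ℂ) ^ n *
        Complex.exp (2 * Real.pi * Complex.I * z * (3 * (n : ℂ) ^ 2 + n) / 2) / (1 + q ^ n)) ∧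
    (∏' n : ℕ, (1 - q ^ (n + 1))) * (∑' n : ℕ, q ^ (n ^ 2) / (qPoch (-q) q n) ^ 2) =
      2 * ∑' n : ℤ,
        (-1 : ℂ) ^ n *
          Complex.exp (2 * Real.pi * Complex.I * z * (3 * (n : ℂ) ^ 2 + n) / 2) / (1 + q ^ n) := by
  have hq0 : q ≠ 0 := hq ▸ Complex.exp_ne_zero _
  have hq1 : ‖q‖ < 1 := by
    rw [hq, Complex.norm_exp, Real.exp_lt_one_iff]
    have : (2 * Real.pi * Complex.I * z).re = -(2 * Real.pi * z.im) := by simp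
    rw [this, neg_lt_zero]
    positivity
  have hexp : ∀ n : ℤ, Complex.exp (2 * Real.pi * Complex.I * z * (3 * (n : ℂ) ^ 2 + n) / 2) =
      q ^ (n * (3 * n + 1) / 2) := by
    intro n
    have heven : Even (n * (3 * n + 1)) := by
      rcases Int.even_or_odd n with h | h
      · exact h.mul_right _
      · exact ((Odd.mul (by decide) h).add_odd odd_one).mul_left _
    obtain ⟨k, hk⟩ := heven.two_dvd
    rw [hk, Int.mul_ediv_cancel_left _ two_ne_zero, hq, ← Complex.exp_int_mul]
    congr 1
    have hk' : (n : ℂ) * (3 * n + 1) = 2 * k := by exact_mod_cast hk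
    linear_combination Real.pi * Complex.I * z * hk'
  simp only [hexp]
  exact ⟨.of_norm_bounded ((summable_pow_natAbs (norm_nonneg q) hq1).mul_right _)
    (norm_watson_term_le hq1 hq0), watson_identity hq1 hq0⟩
end

section
/- Let a ∈ ℝ with a > 0, let b be a positive integer, and let z ∈ ℂ with Im z > 0. Then (1/2) Σ_{n∈ℤ, n≠0} (−1)^n e^{2πiz(an²+bn)} / sinh(2πinz) = Σ_{n=1}^∞ (−1)^n e^{2πian²z} · U_{b−1}( cos(2πnz) ), where U_{m} denotes the degree-m Chebyshev polynomial of the second kind, and both series converge absolutely. -/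
/-- Away from `n = 0`, `sinh (2πinz)` is bounded below by a positive constant. -/
theorem two_pi_im_le_norm_sinh (z : ℂ) (hz : 0 < z.im) (n : ℤ) (hn : n ≠ 0) :
    2 * Real.pi * z.im ≤ ‖Complex.sinh (2 * Real.pi * Complex.I * (n : ℂ) * z)‖ := by
  set w : ℂ := 2 * Real.pi * Complex.I * (n : ℂ) * z with hw
  have hre : w.re = -(2 * Real.pi * n * z.im) := by
    simp [hw]
  have hlow : |Real.sinh w.re| ≤ ‖Complex.sinh w‖ := by
    have h := abs_norm_sub_norm_le (Complex.exp w) (Complex.exp (-w))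
    rw [Complex.norm_exp, Complex.norm_exp, Complex.neg_re] at h
    rw [Complex.sinh, norm_div, Real.sinh_eq, abs_div]
    norm_num
    linarith
  have habs : |w.re| ≤ |Real.sinh w.re| := by
    rw [Real.abs_sinh]
    exact Real.self_le_sinh_iff.2 (abs_nonneg _)
  have hone : (1 : ℝ) ≤ |(n : ℝ)| := by exact_mod_cast Int.one_le_abs hn
  have hpos : 0 < 2 * Real.pi * z.im := by positivity
  calc 2 * Real.pi * z.im ≤ (2 * Real.pi * z.im) * |(n : ℝ)| := by nlinarith
    _ = |w.re| := by
        rw [hre, abs_neg, mul_right_comm _ (n : ℝ), abs_mul, abs_of_pos hpos]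
    _ ≤ ‖Complex.sinh w‖ := habs.trans hlow

theorem summable_exp_quadratic_div_sinh (a : ℝ) (ha : 0 < a) (b z : ℂ) (hz : 0 < z.im) :
    Summable (fun n : ℤ => (-1 : ℂ) ^ n *
      Complex.exp (2 * Real.pi * Complex.I * z * ((a : ℂ) * (n : ℂ) ^ 2 + b * (n : ℂ))) /
      Complex.sinh (2 * Real.pi * Complex.I * (n : ℂ) * z)) := by
  have hpos : 0 < 2 * Real.pi * z.im := by positivity
  have hτ : 0 < (2 * a * z : ℂ).im := by
    have : (2 * a * z : ℂ).im = 2 * a * z.im := by simp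
    rw [this]; positivity
  have htheta := ((summable_jacobiTheta₂_term_iff (b * z) (2 * a * z)).2 hτ).norm
  refine Summable.of_norm_bounded (htheta.mul_right (2 * Real.pi * z.im)⁻¹) fun n => ?_
  have hexp : Complex.exp (2 * Real.pi * Complex.I * z * ((a : ℂ) * (n : ℂ) ^ 2 + b * (n : ℂ))) =
      jacobiTheta₂_term n (b * z) (2 * a * z) := by
    rw [jacobiTheta₂_term]
    ring_nf
  rw [hexp, norm_div, norm_mul, norm_zpow, norm_neg, norm_one, one_zpow, one_mul, div_eq_mul_inv]
  refine mul_le_mul_of_nonneg_left ?_ (norm_nonneg _)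
  rcases eq_or_ne n 0 with rfl | hn
  · simpa using (inv_pos.2 hpos).le
  · exact inv_anti₀ hpos (two_pi_im_le_norm_sinh z hz n hn)

/-- `U_{b-1}(cos θ) sinh(iθ) = sinh(biθ)`. -/
theorem chebyshev_U_cos_mul_sinh (b : ℕ) (θ : ℂ) :
    (Polynomial.Chebyshev.U ℂ ((b : ℤ) - 1)).eval (Complex.cos θ) * Complex.sinh (θ * Complex.I) =
      Complex.sinh (b * (θ * Complex.I)) := by
  have h := Polynomial.Chebyshev.U_complex_cos θ ((b : ℤ) - 1)
  rw [← mul_assoc, Complex.sinh_mul_I, Complex.sinh_mul_I, ← mul_assoc, h]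
  push_cast
  ring_nf

theorem exp_quadratic_div_sinh_add_neg (a b : ℂ) (z : ℂ) (n : ℤ) :
    (-1 : ℂ) ^ n *
        Complex.exp (2 * Real.pi * Complex.I * z * (a * (n : ℂ) ^ 2 + b * (n : ℂ))) /
        Complex.sinh (2 * Real.pi * Complex.I * (n : ℂ) * z) +
      (-1 : ℂ) ^ (-n) *
        Complex.exp (2 * Real.pi * Complex.I * z * (a * ((-n : ℤ) : ℂ) ^ 2 + b * ((-n : ℤ) : ℂ))) /
        Complex.sinh (2 * Real.pi * Complex.I * ((-n : ℤ) : ℂ) * z) =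
    2 * ((-1 : ℂ) ^ n * Complex.exp (2 * Real.pi * Complex.I * a * (n : ℂ) ^ 2 * z) *
      (Complex.sinh (b * (2 * Real.pi * (n : ℂ) * z * Complex.I)) /
        Complex.sinh (2 * Real.pi * (n : ℂ) * z * Complex.I))) := by
  have hsign : (-1 : ℂ) ^ (-n) = (-1) ^ n := by
    rw [zpow_neg, ← inv_zpow]; norm_num
  set w : ℂ := 2 * Real.pi * (n : ℂ) * z * Complex.I with hw
  set q : ℂ := 2 * Real.pi * Complex.I * a * (n : ℂ) ^ 2 * z with hq
  have h₁ : 2 * Real.pi * Complex.I * z * (a * (n : ℂ) ^ 2 + b * (n : ℂ)) = q + b * w := by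
    rw [hw, hq]; ring
  have h₂ : 2 * Real.pi * Complex.I * z * (a * ((-n : ℤ) : ℂ) ^ 2 + b * ((-n : ℤ) : ℂ)) =
      q + -(b * w) := by
    rw [hw, hq]; push_cast; ring
  have h₃ : 2 * Real.pi * Complex.I * (n : ℂ) * z = w := by rw [hw]; ring
  have h₄ : 2 * Real.pi * Complex.I * ((-n : ℤ) : ℂ) * z = -w := by rw [hw]; push_cast; ring
  rw [hsign, h₁, h₂, h₃, h₄, Complex.sinh_neg, Complex.exp_add, Complex.exp_add,
    Complex.sinh.eq_1 (b * w)]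
  ring

/-- For `a > 0`, `b ≥ 1` an integer, `Im z > 0`:
`(1/2) Σ_{n∈ℤ, n≠0} (-1)ⁿ e^{2πiz(an²+bn)}/sinh(2πinz)
  = Σ_{n≥1} (-1)ⁿ e^{2πian²z} U_{b-1}(cos(2πnz))`,
with `U_m` the Chebyshev polynomial of the second kind; both series converge absolutely. -/
theorem stmt10 (a : ℝ) (ha : 0 < a) (b : ℕ) (hb : 1 ≤ b) (z : ℂ) (hz : 0 < z.im) :
    Summable (fun n : {m : ℤ // m ≠ 0} =>
      (-1 : ℂ) ^ (n : ℤ) *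
        Complex.exp (2 * Real.pi * Complex.I * z *
          ((a : ℂ) * ((n : ℤ) : ℂ) ^ 2 + (b : ℂ) * ((n : ℤ) : ℂ))) /
        Complex.sinh (2 * Real.pi * Complex.I * ((n : ℤ) : ℂ) * z)) ∧
    Summable (fun n : ℕ =>
      (-1 : ℂ) ^ (n + 1) * Complex.exp (2 * Real.pi * Complex.I * a * ((n : ℂ) + 1) ^ 2 * z) *
        (Polynomial.Chebyshev.U ℂ ((b : ℤ) - 1)).eval
          (Complex.cos (2 * Real.pi * ((n : ℂ) + 1) * z))) ∧
    (1 / 2 : ℂ) * ∑' n : {m : ℤ // m ≠ 0},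
        (-1 : ℂ) ^ (n : ℤ) *
          Complex.exp (2 * Real.pi * Complex.I * z *
            ((a : ℂ) * ((n : ℤ) : ℂ) ^ 2 + (b : ℂ) * ((n : ℤ) : ℂ))) /
          Complex.sinh (2 * Real.pi * Complex.I * ((n : ℤ) : ℂ) * z) =
      ∑' n : ℕ,
        (-1 : ℂ) ^ (n + 1) * Complex.exp (2 * Real.pi * Complex.I * a * ((n : ℂ) + 1) ^ 2 * z) *
          (Polynomial.Chebyshev.U ℂ ((b : ℤ) - 1)).eval
            (Complex.cos (2 * Real.pi * ((n : ℂ) + 1) * z)) := by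
  set f : ℤ → ℂ := fun n => (-1 : ℂ) ^ n *
    Complex.exp (2 * Real.pi * Complex.I * z * ((a : ℂ) * (n : ℂ) ^ 2 + (b : ℂ) * (n : ℂ))) /
    Complex.sinh (2 * Real.pi * Complex.I * (n : ℂ) * z) with hf
  set g : ℕ → ℂ := fun n =>
    (-1 : ℂ) ^ (n + 1) * Complex.exp (2 * Real.pi * Complex.I * a * ((n : ℂ) + 1) ^ 2 * z) *
      (Polynomial.Chebyshev.U ℂ ((b : ℤ) - 1)).eval
        (Complex.cos (2 * Real.pi * ((n : ℂ) + 1) * z)) with hg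
  have hsum : Summable f := summable_exp_quadratic_div_sinh a ha b z hz
  have hf0 : f 0 = 0 := by simp [hf]
  have hpair : ∀ n : ℕ, f ((n + 1 : ℕ) : ℤ) + f (-((n + 1 : ℕ) : ℤ)) = 2 * g n := by
    intro n
    have hne : Complex.sinh (2 * Real.pi * ((n : ℂ) + 1) * z * Complex.I) ≠ 0 := by
      have h := two_pi_im_le_norm_sinh z hz ((n + 1 : ℕ) : ℤ) (by positivity)
      rw [← norm_pos_iff]
      refine lt_of_lt_of_le (by positivity : 0 < 2 * Real.pi * z.im) (h.trans_eq ?_)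
      push_cast
      ring_nf
    rw [hf, hg]
    refine (exp_quadratic_div_sinh_add_neg a b z ((n + 1 : ℕ) : ℤ)).trans ?_
    rw [zpow_natCast]
    push_cast
    rw [← chebyshev_U_cos_mul_sinh, mul_div_cancel_right₀ _ hne]
  have hnat : HasSum (fun n : ℕ => 2 * g n) (∑' n, f n) := by
    have h := (hasSum_nat_add_iff' 1).2 hsum.hasSum.nat_add_neg
    simpa [hf0, ← hpair] using h
  have hsupp : Function.support f ⊆ {m : ℤ | m ≠ 0} := fun m hm h0 => hm (h0 ▸ hf0)
  have hsub : HasSum (fun n : {m : ℤ // m ≠ 0} => f n) (∑' n, f n) :=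
    (hasSum_subtype_iff_of_support_subset hsupp).2 hsum.hasSum
  have hgsum : HasSum g ((1 / 2 : ℂ) * ∑' n, f n) := by
    simpa using hnat.mul_left (1 / 2 : ℂ)
  refine ⟨hsub.summable, hgsum.summable, ?_⟩
  rw [hgsum.tsum_eq, ← hsub.tsum_eq]
end

section
/- Let a, t ∈ ℝ with a > 0 and let z ∈ ℂ with Im z > 0. Define F₃(a,t;z) := e^{πizt²/(2a)} · ϑ₃( πtz, e^{2πiaz} ) / η_D(2az). Then, with a' := 1/a, z' := −1/(4z), and t' := 2tz/a (so that Im z' > 0 and a' > 0, but t' is in general complex, with ϑ₃ and F₃ extended by the same series/product formulas to complex second argument), one has F₃(a', t'; z') = e^{−iπt²z/(2a)} · F₃(a, t; z). -/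
/-- The Jacobi theta function `ϑ₃(u,Q) = Σ_{n∈ℤ} Q^{n²} e^{2inu}`. -/
noncomputable def theta3 (u Q : ℂ) : ℂ :=
  ∑' n : ℤ, Q ^ (n ^ 2) * Complex.exp (2 * Complex.I * n * u)

/-- The Dedekind eta function `η_D(τ) = e^{πiτ/12} ∏_{n≥1} (1 - e^{2πinτ})`. -/
noncomputable def etaD (τ : ℂ) : ℂ :=
  Complex.exp (Real.pi * Complex.I * τ / 12) *
    ∏' n : ℕ, (1 - Complex.exp (2 * Real.pi * Complex.I * ((n : ℂ) + 1) * τ))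

/-- `F₃(a,t;z) = e^{πizt²/(2a)} ϑ₃(πtz, e^{2πiaz}) / η_D(2az)`, extended to complex `a,t,z`. -/
noncomputable def F3 (a t z : ℂ) : ℂ :=
  Complex.exp (Real.pi * Complex.I * z * t ^ 2 / (2 * a)) *
    theta3 (Real.pi * t * z) (Complex.exp (2 * Real.pi * Complex.I * a * z)) / etaD (2 * a * z)

/-- The theta series in terms of the two-variable Jacobi theta function. -/
theorem theta3_pi_mul_exp (w τ : ℂ) :
    theta3 (Real.pi * w) (Complex.exp (Real.pi * Complex.I * τ)) = jacobiTheta₂ w τ := by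
  refine tsum_congr fun n => ?_
  rw [jacobiTheta₂_term, ← Complex.exp_int_mul, ← Complex.exp_add]
  congr 1
  push_cast
  ring

theorem etaD_eq_eta (τ : ℂ) : etaD τ = ModularForm.eta τ := by
  simp only [etaD, ModularForm.eta, ModularForm.eta_q_eq_cexp, Function.Periodic.qParam]
  congr 2
  push_cast
  ring

theorem sqrt_eq_sqrt_I_mul_cpow {τ : ℂ} (hτ : 0 < τ.im) :
    Complex.sqrt τ = Complex.sqrt Complex.I * (-Complex.I * τ) ^ (1 / 2 : ℂ) := by
  have hne : -Complex.I * τ ≠ 0 := by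
    refine mul_ne_zero (neg_ne_zero.mpr Complex.I_ne_zero) ?_
    rintro rfl
    simp at hτ
  have harg := abs_lt.mp (Complex.abs_arg_lt_pi_div_two_iff.mpr
    (Or.inl (show 0 < (-Complex.I * τ).re by simpa using hτ)))
  have hI : Complex.arg Complex.I = Real.pi / 2 := Complex.arg_I
  have hpi := Real.pi_pos
  have h := Complex.log_mul Complex.I_ne_zero hne (by rw [hI]; constructor <;> linarith)
  have hmul : Complex.I * (-Complex.I * τ) = τ := by
    linear_combination (-τ) * Complex.I_sq
  rw [hmul] at h
  have hτ0 : τ ≠ 0 := by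
    rintro rfl
    simp at hτ
  rw [Complex.sqrt, Complex.sqrt, Complex.cpow_def_of_ne_zero hτ0,
    Complex.cpow_def_of_ne_zero Complex.I_ne_zero, Complex.cpow_def_of_ne_zero hne,
    ← Complex.exp_add, h]
  congr 1
  ring

theorem etaD_neg_one_div {τ : ℂ} (hτ : 0 < τ.im) :
    etaD (-1 / τ) = (-Complex.I * τ) ^ (1 / 2 : ℂ) * etaD τ := by
  have h := ModularForm.eta_comp_eq_csqrt_I_inv hτ
  simp only [Function.comp_apply, Pi.smul_apply, Pi.mul_apply, smul_eq_mul] at h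
  have hI : Complex.sqrt Complex.I ≠ 0 := by
    rw [Complex.sqrt, Complex.cpow_def_of_ne_zero Complex.I_ne_zero]
    exact Complex.exp_ne_zero _
  rw [etaD_eq_eta, etaD_eq_eta, h, sqrt_eq_sqrt_I_mul_cpow hτ]
  field_simp

theorem F3_eq_jacobiTheta₂_div_etaD (a t z : ℂ) :
    F3 a t z = Complex.exp (Real.pi * Complex.I * z * t ^ 2 / (2 * a)) *
      jacobiTheta₂ (t * z) (2 * a * z) / etaD (2 * a * z) := by
  have hw : Real.pi * t * z = Real.pi * (t * z) := by ring
  have hτ : 2 * Real.pi * Complex.I * a * z = Real.pi * Complex.I * (2 * a * z) := by ring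
  rw [F3, hw, hτ, theta3_pi_mul_exp]

/-- For real `a > 0`, real `t`, and `Im z > 0`, with `a' = 1/a`, `z' = -1/(4z)`,
`t' = 2tz/a`: `F₃(a',t';z') = e^{-iπt²z/(2a)} F₃(a,t;z)`. -/
theorem stmt19 (a t : ℝ) (ha : 0 < a) (z : ℂ) (hz : 0 < z.im) :
    F3 (1 / (a : ℂ)) (2 * (t : ℂ) * z / (a : ℂ)) (-1 / (4 * z)) =
      Complex.exp (-Complex.I * Real.pi * (t : ℂ) ^ 2 * z / (2 * (a : ℂ))) * F3 (a : ℂ) (t : ℂ) z := by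
  have hz0 : z ≠ 0 := by
    rintro rfl
    simp at hz
  have ha0 : (a : ℂ) ≠ 0 := by exact_mod_cast ha.ne'
  have hτ : 0 < (2 * (a : ℂ) * z).im := by
    have : (2 * (a : ℂ) * z).im = 2 * a * z.im := by simp
    rw [this]
    positivity
  have hτ' : 2 * (1 / (a : ℂ)) * (-1 / (4 * z)) = -1 / (2 * (a : ℂ) * z) := by
    field_simp
    norm_num
  have hw : 2 * (t : ℂ) * z / a * (-1 / (4 * z)) = -(t * z / (2 * a * z)) := by
    field_simp
    ring
  have hexp : Real.pi * Complex.I * (-1 / (4 * z)) * (2 * (t : ℂ) * z / a) ^ 2 / (2 * (1 / (a : ℂ)))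
      = -Complex.I * Real.pi * (t : ℂ) ^ 2 * z / (2 * a) := by
    field_simp
    norm_num
  have hcancel : Complex.exp (Real.pi * Complex.I * z * (t : ℂ) ^ 2 / (2 * a)) *
      Complex.exp (-Real.pi * Complex.I * (t * z) ^ 2 / (2 * a * z)) = 1 := by
    rw [← Complex.exp_add, Complex.exp_eq_one_iff]
    refine ⟨0, ?_⟩
    field_simp
    simp
  rw [F3_eq_jacobiTheta₂_div_etaD, F3_eq_jacobiTheta₂_div_etaD, hτ', hw, hexp,
    jacobiTheta₂_neg_left, etaD_neg_one_div hτ, jacobiTheta₂_functional_equation (t * z)]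
  set E := Complex.exp (-Complex.I * Real.pi * (t : ℂ) ^ 2 * z / (2 * a))
  set J := jacobiTheta₂ (t * z / (2 * a * z)) (-1 / (2 * a * z))
  set s := (-Complex.I * (2 * a * z)) ^ (1 / 2 : ℂ)
  calc E * J / (s * etaD (2 * a * z)) = E * (1 * (1 / s * J) / etaD (2 * a * z)) := by
        rw [one_mul, div_mul_eq_mul_div, one_mul, div_div, mul_div_assoc]
    _ = _ := by
        rw [← hcancel]
        ring
end
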